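/- arXiv:0809.4205 — 3 statements merged into one kernel-verified Lean document; each statement's English description precedes it below -/
import Mathlib

section
/- Let X and Y be integrable real-valued random variables with X ≤cx Y such that X and Y do not have the same distribution. Then for every integer k ≥ 2, E X_{k:k} < E Y_{k:k} and E Y_{1:k} < E X_{1:k}. -/
open MeasureTheory Filter Topology ProbabilityTheory

noncomputable section

/-- `ConvexOrder μ ν` means the distribution `μ` is dominated by `ν` in the convex order:
`∫ φ dμ ≤ ∫ φ dν` for every convex function `φ : ℝ → ℝ` for which both integrals are
well defined. -/
def ConvexOrder (μ ν : Measure ℝ) : Prop :=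
  ∀ φ : ℝ → ℝ, ConvexOn ℝ Set.univ φ → Integrable φ μ → Integrable φ ν →
    ∫ x, φ x ∂μ ≤ ∫ x, φ x ∂ν

/-- The discrete measure on `ℝ` supported on the nonnegative integers with weights `w k`. -/
def discreteMeasure (w : ℕ → ℝ) : Measure ℝ :=
  Measure.sum fun k => ENNReal.ofReal (w k) • Measure.dirac (k : ℝ)

/-- The Poisson probabilities with mean `θ`. -/
def poissonPMFReal (θ : ℝ) (k : ℕ) : ℝ := Real.exp (-θ) * θ ^ k / k.factorial

/-- The Poisson distribution with mean `θ`, as a measure on `ℝ`. -/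
def poissonMeasure (θ : ℝ) : Measure ℝ := discreteMeasure (poissonPMFReal θ)

/-- The binomial probabilities with parameters `m` and `q`. -/
def binomialPMFReal (m : ℕ) (q : ℝ) (k : ℕ) : ℝ :=
  (m.choose k) * q ^ k * (1 - q) ^ (m - k)

/-- The binomial distribution with parameters `m` and `q`, as a measure on `ℝ`. -/
def binomialMeasure (m : ℕ) (q : ℝ) : Measure ℝ := discreteMeasure (binomialPMFReal m q)

/-- The negative binomial probabilities: `P(Z(t,θ) = k) =
(Γ(k + 1/t)/(k! Γ(1/t))) (θt)^k / (1 + θt)^(k + 1/t)`; this distribution has mean `θ`. -/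
def negBinomialPMFReal (t θ : ℝ) (k : ℕ) : ℝ :=
  Real.Gamma (k + 1 / t) / (k.factorial * Real.Gamma (1 / t)) * (θ * t) ^ k /
    (1 + θ * t) ^ ((k : ℝ) + 1 / t)

/-- The negative binomial distribution `Z(t,θ)`, as a measure on `ℝ`. -/
def negBinomialMeasure (t θ : ℝ) : Measure ℝ := discreteMeasure (negBinomialPMFReal t θ)

/-- Zero inflation: the mixture of the point mass at `0` with weight `p` and `μ` with
weight `1 - p`. -/
def ziMeasure (p : ℝ) (μ : Measure ℝ) : Measure ℝ :=
  ENNReal.ofReal p • Measure.dirac (0 : ℝ) + ENNReal.ofReal (1 - p) • μ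

/-- The zero-inflated Poisson distribution `Y(θ,p)`: mixture of the point mass at `0` with
weight `p` and the Poisson distribution with mean `θ/(1-p)` with weight `1-p`. -/
def ZIP (θ p : ℝ) : Measure ℝ := ziMeasure p (poissonMeasure (θ / (1 - p)))

/-- The zero-inflated binomial distribution `X(m,θ,p)`: mixture of the point mass at `0` with
weight `p` and the binomial distribution with parameters `m` and `θ/(m(1-p))` with
weight `1-p`. -/
def ZIB (m : ℕ) (θ p : ℝ) : Measure ℝ :=
  ziMeasure p (binomialMeasure m (θ / (m * (1 - p))))

/-- The zero-inflated negative binomial distribution of the first kind `Z₁(t,θ,p)`: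
mixture of the point mass at `0` with weight `p` and `Z(t(1-p), θ/(1-p))` with weight `1-p`. -/
def ZINB₁ (t θ p : ℝ) : Measure ℝ :=
  ziMeasure p (negBinomialMeasure (t * (1 - p)) (θ / (1 - p)))

/-- The zero-inflated negative binomial distribution of the second kind `Z₂(t,θ,p)`:
mixture of the point mass at `0` with weight `p` and `Z(t, θ/(1-p))` with weight `1-p`. -/
def ZINB₂ (t θ p : ℝ) : Measure ℝ :=
  ziMeasure p (negBinomialMeasure t (θ / (1 - p)))

/-- The probability mass function of the zero-inflated negative binomial
distribution `Z₂(t,θ,p)`. -/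
def zinb2PMFReal (t θ p : ℝ) (k : ℕ) : ℝ :=
  (if k = 0 then p else 0) + (1 - p) * negBinomialPMFReal t (θ / (1 - p)) k

/-- The expected value of the maximum of `k` independent copies of a random variable with
distribution `μ`. -/
def expMax (μ : Measure ℝ) (k : ℕ) : ℝ :=
  ∫ x : Fin k → ℝ, (⨆ i, x i) ∂(Measure.pi fun _ => μ)

/-- The expected value of the minimum of `k` independent copies of a random variable with
distribution `μ`. -/
def expMin (μ : Measure ℝ) (k : ℕ) : ℝ :=
  ∫ x : Fin k → ℝ, (⨅ i, x i) ∂(Measure.pi fun _ => μ)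

/-- The modified Bessel function of the first kind of integer order `n`. -/
def besselI (n : ℕ) (x : ℝ) : ℝ :=
  ∑' j : ℕ, (x / 2) ^ (2 * j + n) / (j.factorial * (j + n).factorial)

/-- `M₂ θ`: the expected value of the maximum of two independent Poisson random variables
with mean `θ`. -/
def M₂ (x : ℝ) : ℝ := x + x * Real.exp (-2 * x) * (besselI 0 (2 * x) + besselI 1 (2 * x))

/-- The discrepancy `Δ₂:₂(θ,p) = 2pθ + (1-p)² M₂(θ/(1-p)) − M₂(θ)`. -/
def Δdisc (θ p : ℝ) : ℝ := 2 * p * θ + (1 - p) ^ 2 * M₂ (θ / (1 - p)) - M₂ θ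

/-- The asymptotic variance `σ²(θ)` of `√n Δ₂:₂` under the Poisson null hypothesis. -/
def σsq (θ : ℝ) : ℝ :=
  θ ^ 2 * (1 - Real.exp (-2 * θ) *
      ((1 + θ) * besselI 0 (2 * θ) - besselI 1 (2 * θ) + θ * besselI 2 (2 * θ))) ^ 2 /
    (Real.exp θ - 1 - θ)


/-- The expected value of the maximum of `t` and a random variable with distribution `μ`. -/
def meanMax (μ : Measure ℝ) (t : ℝ) : ℝ := ∫ x, max x t ∂μ

section MeanMax

variable {μ ν : Measure ℝ} [IsProbabilityMeasure μ] [IsProbabilityMeasure ν]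

lemma integrable_max_const (hμ : Integrable id μ) (t : ℝ) : Integrable (fun x => max x t) μ :=
  hμ.sup (integrable_const t)

lemma abs_max_sub_max_le (x s t : ℝ) : |max x s - max x t| ≤ |s - t| := by
  simpa using abs_max_sub_max_le_max x s x t

lemma abs_meanMax_sub_le (hμ : Integrable id μ) (s t : ℝ) :
    |meanMax μ s - meanMax μ t| ≤ |s - t| := by
  unfold meanMax
  rw [← integral_sub (integrable_max_const hμ s) (integrable_max_const hμ t)]
  simpa using norm_integral_le_of_norm_le_const (μ := μ) (f := fun x => max x s - max x t)
    (C := |s - t|) (ae_of_all _ fun x => abs_max_sub_max_le x s t)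

lemma continuous_meanMax (hμ : Integrable id μ) : Continuous (meanMax μ) :=
  (LipschitzWith.of_dist_le_mul (K := 1) fun s t => by
    simpa [Real.dist_eq] using abs_meanMax_sub_le hμ s t).continuous

lemma integrable_meanMax {ρ : Measure ℝ} [IsProbabilityMeasure ρ] (hμ : Integrable id μ)
    (hρ : Integrable id ρ) : Integrable (meanMax μ) ρ := by
  refine (hρ.norm.add (integrable_const |meanMax μ 0|)).mono'
    (continuous_meanMax hμ).aestronglyMeasurable (ae_of_all _ fun t => ?_)
  have h := abs_meanMax_sub_le hμ t 0
  have h' := abs_add_le (meanMax μ t - meanMax μ 0) (meanMax μ 0)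
  simp only [sub_zero, sub_add_cancel] at h h'
  simp only [Pi.add_apply, id, Real.norm_eq_abs]
  linarith

lemma tendsto_meanMax_atBot (hμ : Integrable id μ) :
    Tendsto (meanMax μ) atBot (𝓝 (∫ x, x ∂μ)) := by
  refine tendsto_integral_filter_of_dominated_convergence (fun x => |x|)
    (Eventually.of_forall fun t => (integrable_max_const hμ t).aestronglyMeasurable) ?_
    hμ.norm (ae_of_all _ fun x => ?_)
  · filter_upwards [eventually_le_atBot 0] with t ht
    refine ae_of_all _ fun x => ?_
    rw [Real.norm_eq_abs, abs_le]
    exact ⟨(neg_abs_le x).trans (le_max_left _ _),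
      max_le (le_abs_self x) (ht.trans (abs_nonneg x))⟩
  · refine tendsto_const_nhds.congr' ?_
    filter_upwards [eventually_le_atBot x] with t ht
    rw [max_eq_left ht]

lemma tendsto_meanMax_sub_atTop (hμ : Integrable id μ) :
    Tendsto (fun t => meanMax μ t - t) atTop (𝓝 0) := by
  have h : (fun t => meanMax μ t - t) = fun t => ∫ x, (max x t - t) ∂μ := by
    ext t
    rw [integral_sub (integrable_max_const hμ t) (integrable_const t)]
    simp [meanMax]
  rw [h, ← integral_zero ℝ ℝ (μ := μ)]
  refine tendsto_integral_filter_of_dominated_convergence (fun x => |x|)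
    (Eventually.of_forall fun t =>
      ((integrable_max_const hμ t).sub (integrable_const t)).aestronglyMeasurable) ?_
    hμ.norm (ae_of_all _ fun x => ?_)
  · filter_upwards [eventually_ge_atTop 0] with t ht
    refine ae_of_all _ fun x => ?_
    rw [Real.norm_eq_abs, abs_of_nonneg (sub_nonneg.2 (le_max_right _ _)), sub_le_iff_le_add]
    exact max_le ((le_abs_self x).trans (by linarith)) (by linarith [abs_nonneg x])
  · refine tendsto_const_nhds.congr' ?_
    filter_upwards [eventually_ge_atTop x] with t ht
    rw [max_eq_right ht, sub_self]

/-- The right derivative of `meanMax μ` is the distribution function of `μ`. -/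
lemma tendsto_slope_meanMax (hμ : Integrable id μ) (t : ℝ) :
    Tendsto (fun h => h⁻¹ * (meanMax μ (t + h) - meanMax μ t)) (𝓝[>] 0)
      (𝓝 (μ.real (Set.Iic t))) := by
  have h1 : (fun h => h⁻¹ * (meanMax μ (t + h) - meanMax μ t)) =
      fun h => ∫ x, h⁻¹ * (max x (t + h) - max x t) ∂μ := by
    ext h
    rw [integral_const_mul, integral_sub (integrable_max_const hμ _) (integrable_max_const hμ _)]
    rfl
  have h2 : μ.real (Set.Iic t) = ∫ x, (Set.Iic t).indicator (fun _ => (1 : ℝ)) x ∂μ := by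
    rw [integral_indicator_const _ measurableSet_Iic]; simp
  rw [h1, h2]
  refine tendsto_integral_filter_of_dominated_convergence (fun _ => 1)
    (Eventually.of_forall fun h => by fun_prop) ?_ (integrable_const _)
    (ae_of_all _ fun x => ?_)
  · filter_upwards [self_mem_nhdsWithin] with h hh
    refine ae_of_all _ fun x => ?_
    have hpos : (0 : ℝ) < h := hh
    have := abs_max_sub_max_le x (t + h) t
    rw [add_sub_cancel_left, abs_of_pos hpos] at this
    rw [norm_mul, norm_inv, Real.norm_eq_abs, Real.norm_eq_abs, abs_of_pos hpos,
      inv_mul_le_iff₀ hpos]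
    simpa using this
  · refine tendsto_const_nhds.congr' ?_
    rcases le_or_gt x t with hx | hx
    · filter_upwards [self_mem_nhdsWithin] with h hh
      have hpos : (0 : ℝ) < h := hh
      rw [Set.indicator_of_mem (Set.mem_Iic.2 hx), max_eq_right hx, max_eq_right (by linarith),
        add_sub_cancel_left, inv_mul_cancel₀ hpos.ne']
    · filter_upwards [nhdsWithin_le_nhds (eventually_lt_nhds (sub_pos.2 hx))] with h hh
      rw [Set.indicator_of_notMem (by simpa using hx), max_eq_left hx.le,
        max_eq_left (by linarith), sub_self, mul_zero]

lemma eq_of_meanMax_eq (hμ : Integrable id μ) (hν : Integrable id ν)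
    (h : meanMax μ = meanMax ν) : μ = ν := by
  refine Measure.ext_of_Iic μ ν fun t => ?_
  have h1 := tendsto_slope_meanMax hμ t
  rw [h] at h1
  exact (measureReal_eq_measureReal_iff).1 (tendsto_nhds_unique h1 (tendsto_slope_meanMax hν t))

lemma two_mul_max_le (x t d : ℝ) : 2 * max x t ≤ max x (t + d) + max x (t - d) := by
  rcases max_cases x t with h | h <;>
    linarith [le_max_left x (t + d), le_max_left x (t - d), le_max_right x (t + d),
      le_max_right x (t - d)]

lemma max_add_max_of_abs_le {x t d : ℝ} (h : |d| ≤ |x - t|) :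
    max x (t + d) + max x (t - d) = 2 * max x t := by
  rcases le_total x t with hx | hx
  · rw [abs_of_nonpos (sub_nonpos.2 hx), abs_le] at h
    rw [max_eq_right hx, max_eq_right (by linarith), max_eq_right (by linarith)]
    ring
  · rw [abs_of_nonneg (sub_nonneg.2 hx), abs_le] at h
    rw [max_eq_left hx, max_eq_left (by linarith), max_eq_left (by linarith)]
    ring

lemma two_mul_meanMax_le (hμ : Integrable id μ) (t d : ℝ) :
    2 * meanMax μ t ≤ meanMax μ (t + d) + meanMax μ (t - d) := by
  unfold meanMax
  rw [← integral_const_mul,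
    ← integral_add (integrable_max_const hμ _) (integrable_max_const hμ _)]
  exact integral_mono ((integrable_max_const hμ _).const_mul _)
    ((integrable_max_const hμ _).add (integrable_max_const hμ _)) fun x => two_mul_max_le x t d

lemma meanMax_add_meanMax_of_ball_null (hμ : Integrable id μ) {t ε d : ℝ}
    (hball : μ (Metric.ball t ε) = 0) (hd : |d| < ε) :
    meanMax μ (t + d) + meanMax μ (t - d) = 2 * meanMax μ t := by
  unfold meanMax
  rw [← integral_const_mul,
    ← integral_add (integrable_max_const hμ _) (integrable_max_const hμ _)]
  refine integral_congr_ae ?_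
  filter_upwards [measure_eq_zero_iff_ae_notMem.1 hball] with x hx
  rw [Metric.mem_ball, Real.dist_eq, not_lt] at hx
  exact max_add_max_of_abs_le (hd.le.trans hx)

/-- A maximum principle: where `meanMax μ < meanMax ν`, the measure `μ` has to put some mass. -/
lemma measure_meanMax_lt_ne_zero (hμ : Integrable id μ) (hν : Integrable id ν)
    (hmean : ∫ x, x ∂μ = ∫ x, x ∂ν) (hle : ∀ t, meanMax μ t ≤ meanMax ν t) (hne : μ ≠ ν) :
    μ {t | meanMax μ t < meanMax ν t} ≠ 0 := by
  intro hnull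
  set D : ℝ → ℝ := fun t => meanMax ν t - meanMax μ t with hD
  have hcont : Continuous D := (continuous_meanMax hν).sub (continuous_meanMax hμ)
  have hbot : Tendsto D atBot (𝓝 0) := by
    simpa [hmean] using (tendsto_meanMax_atBot hν).sub (tendsto_meanMax_atBot hμ)
  have htop : Tendsto D atTop (𝓝 0) := by
    simpa [hD] using (tendsto_meanMax_sub_atTop hν).sub (tendsto_meanMax_sub_atTop hμ)
  obtain ⟨t₁, ht₁⟩ : ∃ t, 0 < D t := by
    by_contra! h
    exact hne (eq_of_meanMax_eq hμ hν
      (funext fun t => le_antisymm (hle t) (sub_nonpos.1 (h t))))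
  obtain ⟨t₀, ht₀⟩ : ∃ t₀, ∀ t, D t ≤ D t₀ := by
    refine hcont.exists_forall_ge' t₁ ?_
    rw [cocompact_eq_atBot_atTop, eventually_sup]
    exact ⟨(hbot.eventually_lt_const ht₁).mono fun _ h => h.le,
      (htop.eventually_lt_const ht₁).mono fun _ h => h.le⟩
  have hpos : 0 < D t₀ := ht₁.trans_le (ht₀ t₁)
  have hopen : IsOpen {t | D t = D t₀} := by
    rw [Metric.isOpen_iff]
    intro t ht
    have ht : D t = D t₀ := ht
    have hU : IsOpen {t | meanMax μ t < meanMax ν t} :=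
      isOpen_lt (continuous_meanMax hμ) (continuous_meanMax hν)
    obtain ⟨ε, hε, hsub⟩ := Metric.isOpen_iff.1 hU t (sub_pos.1 (ht ▸ hpos))
    refine ⟨ε, hε, fun s hs => ?_⟩
    rw [Metric.mem_ball, Real.dist_eq] at hs
    have h1 := meanMax_add_meanMax_of_ball_null hμ (measure_mono_null hsub hnull) hs
    have h2 := two_mul_meanMax_le hν t (s - t)
    rw [add_sub_cancel] at h1 h2
    have h3 := ht₀ s
    have h4 := ht₀ (t - (s - t))
    simp only [hD, Set.mem_ofPred_eq] at *
    linarith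
  have huniv := IsClopen.eq_univ ⟨isClosed_eq hcont continuous_const, hopen⟩ ⟨t₀, rfl⟩
  have hconst : D = fun _ => D t₀ := funext fun t => by
    have : t ∈ {t | D t = D t₀} := huniv ▸ Set.mem_univ t
    exact this
  rw [hconst] at htop
  exact hpos.ne (tendsto_nhds_unique htop tendsto_const_nhds)

lemma integrable_max_prod (hμ : Integrable id μ) (hν : Integrable id ν) :
    Integrable (fun p : ℝ × ℝ => max p.1 p.2) (μ.prod ν) :=
  (hμ.comp_fst ν).sup (hν.comp_snd μ)

lemma integral_max_prod (hμ : Integrable id μ) (hν : Integrable id ν) :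
    ∫ p : ℝ × ℝ, max p.1 p.2 ∂(μ.prod ν) = ∫ x, meanMax ν x ∂μ := by
  rw [integral_prod _ (integrable_max_prod hμ hν)]
  simp_rw [meanMax, max_comm]

lemma integral_max_max_prod (hμ : Integrable id μ) (hν : Integrable id ν) (c : ℝ) :
    ∫ p : ℝ × ℝ, max (max p.1 p.2) c ∂(μ.prod ν) = ∫ x, meanMax ν (max x c) ∂μ := by
  have hint : Integrable (fun p : ℝ × ℝ => max (max p.1 p.2) c) (μ.prod ν) :=
    (integrable_max_prod hμ hν).sup (integrable_const c)
  rw [integral_prod _ hint]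
  refine integral_congr_ae (ae_of_all _ fun x => integral_congr_ae (ae_of_all _ fun y => ?_))
  simp only [max_assoc, max_left_comm]

lemma integrable_meanMax_max {ρ : Measure ℝ} [IsProbabilityMeasure ρ] (hμ : Integrable id μ)
    (hρ : Integrable id ρ) (c : ℝ) : Integrable (fun x => meanMax μ (max x c)) ρ := by
  have h : Integrable id (ρ.map fun x => max x c) :=
    (integrable_map_measure (by fun_prop) (by fun_prop)).2 (integrable_max_const hρ c)
  have : IsProbabilityMeasure (ρ.map fun x => max x c) :=
    Measure.isProbabilityMeasure_map (by fun_prop)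
  exact (integrable_meanMax hμ h).comp_measurable (by fun_prop)

lemma integral_meanMax_comm (hμ : Integrable id μ) (hν : Integrable id ν) :
    ∫ x, meanMax μ x ∂ν = ∫ x, meanMax ν x ∂μ := by
  rw [← integral_max_prod hμ hν, ← integral_max_prod hν hμ, ← integral_prod_swap]
  simp_rw [Prod.fst_swap, Prod.snd_swap, max_comm]

lemma integral_meanMax_max_comm (hμ : Integrable id μ) (hν : Integrable id ν) (c : ℝ) :
    ∫ x, meanMax μ (max x c) ∂ν = ∫ x, meanMax ν (max x c) ∂μ := by
  rw [← integral_max_max_prod hμ hν, ← integral_max_max_prod hν hμ, ← integral_prod_swap]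
  simp only [Prod.fst_swap, Prod.snd_swap, max_comm]

end MeanMax

/-- The distribution of the maximum of `n + 1` independent random variables with
distribution `μ`. -/
def maxLaw (μ : Measure ℝ) : ℕ → Measure ℝ
  | 0 => μ
  | n + 1 => (μ.prod (maxLaw μ n)).map fun p => max p.1 p.2

section MaxLaw

variable (μ : Measure ℝ) [IsProbabilityMeasure μ]

instance isProbabilityMeasure_maxLaw (n : ℕ) : IsProbabilityMeasure (maxLaw μ n) := by
  induction n with
  | zero => assumption
  | succ n ih => exact Measure.isProbabilityMeasure_map (by fun_prop)

lemma ciSup_fin_succ {n : ℕ} (x : Fin (n + 2) → ℝ) :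
    ⨆ i, x i = max (x 0) (⨆ i : Fin (n + 1), x i.succ) := by
  refine le_antisymm (ciSup_le fun i => ?_)
    (max_le (le_ciSup (Set.finite_range x).bddAbove 0)
      (ciSup_le fun i => le_ciSup (Set.finite_range x).bddAbove i.succ))
  refine Fin.cases (le_max_left _ _) (fun j => ?_) i
  exact (le_ciSup (f := fun i : Fin (n + 1) => x i.succ)
    (Set.finite_range _).bddAbove j).trans (le_max_right _ _)

lemma map_iSup_pi (n : ℕ) :
    (Measure.pi fun _ : Fin (n + 1) => μ).map (fun x => ⨆ i, x i) = maxLaw μ n := by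
  induction n with
  | zero =>
    have h := (measurePreserving_eval (fun _ : Fin 1 => μ) 0).map_eq
    have hev : (fun x : Fin 1 → ℝ => ⨆ i, x i) = Function.eval 0 := by
      ext x
      simp [Function.eval]
    rw [hev, h, maxLaw]
  | succ n ih =>
    have h := measurePreserving_piFinSuccAbove (fun _ : Fin (n + 2) => μ) 0
    have hm : Measurable fun x : Fin (n + 1) → ℝ => ⨆ i, x i := by fun_prop
    have hprod : (μ.prod (maxLaw μ n)) = (μ.prod (Measure.pi fun _ : Fin (n + 1) => μ)).map
        (Prod.map id fun x => ⨆ i, x i) := by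
      rw [← Measure.map_prod_map _ _ measurable_id hm, ih, Measure.map_id]
    rw [maxLaw, hprod, ← h.map_eq, Measure.map_map (by fun_prop) (by fun_prop),
      Measure.map_map (by fun_prop) (by fun_prop)]
    congr 1
    ext x
    exact ciSup_fin_succ x

lemma expMax_succ (n : ℕ) : expMax μ (n + 1) = ∫ x, x ∂(maxLaw μ n) := by
  rw [← map_iSup_pi, integral_map (by fun_prop) (by fun_prop), expMax]

lemma pow_le_maxLaw (n : ℕ) {s : Set ℝ} (hs : MeasurableSet s) : μ s ^ (n + 1) ≤ maxLaw μ n s := by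
  induction n with
  | zero => simp [maxLaw]
  | succ n ih =>
    rw [maxLaw, Measure.map_apply (by fun_prop) hs, pow_succ']
    calc μ s * μ s ^ (n + 1) ≤ μ s * maxLaw μ n s := by gcongr
      _ = (μ.prod (maxLaw μ n)) (s ×ˢ s) := (Measure.prod_prod _ _).symm
      _ ≤ _ := measure_mono fun p hp => by
        rcases max_choice p.1 p.2 with h | h
        · simpa [h] using hp.1
        · simpa [h] using hp.2

variable {μ}

lemma integrable_maxLaw (hμ : Integrable id μ) (n : ℕ) : Integrable id (maxLaw μ n) := by
  induction n with
  | zero => exact hμ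
  | succ n ih =>
    exact (integrable_map_measure (by fun_prop) (by fun_prop)).2 (integrable_max_prod hμ ih)

lemma meanMax_maxLaw_succ (hμ : Integrable id μ) (n : ℕ) (c : ℝ) :
    meanMax (maxLaw μ (n + 1)) c = ∫ x, meanMax (maxLaw μ n) (max x c) ∂μ := by
  rw [meanMax, maxLaw, integral_map (by fun_prop) (by fun_prop),
    integral_max_max_prod hμ (integrable_maxLaw hμ n)]

lemma integral_maxLaw_succ (hμ : Integrable id μ) (n : ℕ) :
    ∫ x, x ∂(maxLaw μ (n + 1)) = ∫ x, meanMax (maxLaw μ n) x ∂μ := by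
  rw [maxLaw, integral_map (by fun_prop) (by fun_prop),
    integral_max_prod hμ (integrable_maxLaw hμ n)]

variable {ν : Measure ℝ} [IsProbabilityMeasure ν]

lemma meanMax_maxLaw_le (hμ : Integrable id μ) (hν : Integrable id ν)
    (hle : ∀ t, meanMax μ t ≤ meanMax ν t) (n : ℕ) :
    ∀ t, meanMax (maxLaw μ n) t ≤ meanMax (maxLaw ν n) t := by
  induction n with
  | zero => exact hle
  | succ n ih =>
    intro t
    have hM := integrable_maxLaw hμ n
    have hN := integrable_maxLaw hν n
    calc meanMax (maxLaw μ (n + 1)) t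
        = ∫ x, meanMax μ (max x t) ∂(maxLaw μ n) := by
          rw [meanMax_maxLaw_succ hμ, integral_meanMax_max_comm hM hμ]
      _ ≤ ∫ x, meanMax ν (max x t) ∂(maxLaw μ n) :=
          integral_mono (integrable_meanMax_max hμ hM t) (integrable_meanMax_max hν hM t)
            fun x => hle _
      _ = ∫ x, meanMax (maxLaw μ n) (max x t) ∂ν := integral_meanMax_max_comm hν hM t
      _ ≤ ∫ x, meanMax (maxLaw ν n) (max x t) ∂ν :=
          integral_mono (integrable_meanMax_max hM hν t) (integrable_meanMax_max hN hν t)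
            fun x => ih _
      _ = meanMax (maxLaw ν (n + 1)) t := (meanMax_maxLaw_succ hν n t).symm

end MaxLaw

section ConvexOrder

variable {μ ν : Measure ℝ}

lemma ConvexOrder.integral_eq (hcx : ConvexOrder μ ν) (hμ : Integrable id μ)
    (hν : Integrable id ν) : ∫ x, x ∂μ = ∫ x, x ∂ν := by
  refine le_antisymm (hcx id (convexOn_id convex_univ) hμ hν) ?_
  have h := hcx (fun x => -x) (concaveOn_id convex_univ).neg hμ.neg hν.neg
  rw [integral_neg, integral_neg] at h
  linarith

lemma ConvexOrder.meanMax_le [IsProbabilityMeasure μ] [IsProbabilityMeasure ν]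
    (hcx : ConvexOrder μ ν) (hμ : Integrable id μ) (hν : Integrable id ν) (t : ℝ) :
    meanMax μ t ≤ meanMax ν t :=
  hcx _ ((convexOn_id convex_univ).sup (convexOn_const t convex_univ))
    (integrable_max_const hμ t) (integrable_max_const hν t)

lemma ConvexOrder.map_neg (hcx : ConvexOrder μ ν) :
    ConvexOrder (μ.map Neg.neg) (ν.map Neg.neg) := by
  intro φ hφ h1 h2
  have hm : Measurable φ :=
    (continuousOn_univ.1 (hφ.continuousOn isOpen_univ)).measurable
  rw [integral_map (by fun_prop) hm.aestronglyMeasurable,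
    integral_map (by fun_prop) hm.aestronglyMeasurable]
  refine hcx _ ?_ (h1.comp_measurable measurable_neg) (h2.comp_measurable measurable_neg)
  exact hφ.comp_linearMap (-LinearMap.id : ℝ →ₗ[ℝ] ℝ)

theorem ConvexOrder.expMax_lt [IsProbabilityMeasure μ] [IsProbabilityMeasure ν]
    (hcx : ConvexOrder μ ν) (hμ : Integrable id μ) (hν : Integrable id ν) (hne : μ ≠ ν)
    {k : ℕ} (hk : 2 ≤ k) : expMax μ k < expMax ν k := by
  obtain ⟨n, rfl⟩ := Nat.exists_eq_add_of_le' hk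
  have hle := hcx.meanMax_le hμ hν
  have hM := integrable_maxLaw hμ n
  have hN := integrable_maxLaw hν n
  have hstrict : ∫ x, meanMax μ x ∂(maxLaw μ n) < ∫ x, meanMax ν x ∂(maxLaw μ n) := by
    refine (integral_mono (integrable_meanMax hμ hM) (integrable_meanMax hν hM) hle).lt_of_ne
      fun heq => ?_
    have hae := (integral_eq_iff_of_ae_le (integrable_meanMax hμ hM) (integrable_meanMax hν hM)
      (ae_of_all _ hle)).1 heq
    have h0 : maxLaw μ n {t | meanMax μ t < meanMax ν t} = 0 :=
      measure_eq_zero_iff_ae_notMem.2 (hae.mono fun t ht => ht.not_lt)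
    have hU : MeasurableSet {t | meanMax μ t < meanMax ν t} :=
      (isOpen_lt (continuous_meanMax hμ) (continuous_meanMax hν)).measurableSet
    exact measure_meanMax_lt_ne_zero hμ hν (hcx.integral_eq hμ hν) hle hne
      (eq_zero_of_pow_eq_zero (le_zero_iff.1 (h0 ▸ pow_le_maxLaw μ n hU)))
  calc expMax μ (n + 2)
      = ∫ x, meanMax μ x ∂(maxLaw μ n) := by
        rw [expMax_succ, integral_maxLaw_succ hμ, integral_meanMax_comm hM hμ]
    _ < ∫ x, meanMax ν x ∂(maxLaw μ n) := hstrict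
    _ = ∫ x, meanMax (maxLaw μ n) x ∂ν := integral_meanMax_comm hν hM
    _ ≤ ∫ x, meanMax (maxLaw ν n) x ∂ν :=
        integral_mono (integrable_meanMax hM hν) (integrable_meanMax hN hν)
          (meanMax_maxLaw_le hμ hν hle n)
    _ = expMax ν (n + 2) := by rw [expMax_succ, integral_maxLaw_succ hν]

end ConvexOrder

lemma expMin_eq_neg_expMax_map_neg (μ : Measure ℝ) [IsProbabilityMeasure μ] (k : ℕ) :
    expMin μ k = -expMax (μ.map Neg.neg) k := by
  have : IsProbabilityMeasure (μ.map Neg.neg) :=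
    Measure.isProbabilityMeasure_map (by fun_prop)
  have h := measurePreserving_pi (fun _ : Fin k => μ) (fun _ => μ.map Neg.neg)
    fun _ => (measurable_neg (G := ℝ)).measurePreserving μ
  rw [expMax, ← h.map_eq, integral_map h.measurable.aemeasurable (by fun_prop), ← integral_neg, expMin]
  refine integral_congr_ae (ae_of_all _ fun x => ?_)
  simp only [iInf, iSup, Real.sInf_def]
  congr 2
  ext y
  simp [neg_eq_iff_eq_neg]

/-- If `X ≤cx Y` and `X`, `Y` do not have the same distribution, then for every
`k ≥ 2`, `E X_{k:k} < E Y_{k:k}` and `E Y_{1:k} < E X_{1:k}`. -/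
theorem expected_extremes_lt_of_convexOrder_of_ne
    (μ ν : Measure ℝ) [IsProbabilityMeasure μ] [IsProbabilityMeasure ν]
    (hμ : Integrable id μ) (hν : Integrable id ν)
    (hcx : ConvexOrder μ ν) (hne : μ ≠ ν) :
    ∀ k : ℕ, 2 ≤ k → expMax μ k < expMax ν k ∧ expMin ν k < expMin μ k := by
  intro k hk
  refine ⟨hcx.expMax_lt hμ hν hne hk, ?_⟩
  have : IsProbabilityMeasure (μ.map Neg.neg) :=
    Measure.isProbabilityMeasure_map (by fun_prop)
  have : IsProbabilityMeasure (ν.map Neg.neg) :=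
    Measure.isProbabilityMeasure_map (by fun_prop)
  rw [expMin_eq_neg_expMax_map_neg, expMin_eq_neg_expMax_map_neg, neg_lt_neg_iff]
  refine hcx.map_neg.expMax_lt ?_ ?_ (fun h => hne ?_) hk
  · exact (integrable_map_measure (by fun_prop) (by fun_prop)).2 hμ.neg
  · exact (integrable_map_measure (by fun_prop) (by fun_prop)).2 hν.neg
  · exact (MeasurableEquiv.neg ℝ).map_measurableEquiv_injective h

end
end

section
/- For every t > 0, θ > 0 and 0 ≤ p₁ < p₂ < 1, the zero-inflated negative binomial variables of the first kind satisfy Z₁(t,θ,p₁) ≤cx Z₁(t,θ,p₂). -/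
open MeasureTheory Filter Topology ProbabilityTheory

noncomputable section

/-- The binomial series with coefficients written through the Gamma function. -/
lemma hasSum_Gamma_div_mul_pow {r x : ℝ} (hr : 0 < r) (hx₀ : 0 ≤ x) (hx₁ : x < 1) :
    HasSum (fun k : ℕ => Real.Gamma (k + r) / (k.factorial * Real.Gamma r) * x ^ k)
      (1 / (1 - x) ^ r) := by
  have hc (k : ℕ) : Real.Gamma (k + r) / (k.factorial * Real.Gamma r)
      = Ring.choose (r + k - 1) k := by
    have hG := (Real.Gamma_pos_of_pos hr).ne'
    have hfac : (k.factorial : ℝ) ≠ 0 := by positivity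
    have hP : Real.Gamma (k + r) = (ascPochhammer ℝ k).eval r * Real.Gamma r := by
      induction k with
      | zero => simp
      | succ k ih =>
        rw [show ((k + 1 : ℕ) : ℝ) + r = (k + r) + 1 by push_cast; ring,
          Real.Gamma_add_one (by positivity), ih (by positivity), ascPochhammer_succ_eval]
        ring
    have hm := Ring.factorial_nsmul_multichoose_eq_ascPochhammer r k
    rw [Polynomial.ascPochhammer_smeval_eq_eval, nsmul_eq_mul] at hm
    rw [← Ring.multichoose_eq, hP, ← hm]
    field_simp
  have h := (Real.one_div_one_sub_rpow_hasFPowerSeriesOnBall_zero r).hasSum (y := x)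
    (by simpa [abs_of_nonneg hx₀, enorm_eq_nnnorm, ← NNReal.coe_lt_coe] using hx₁)
  simpa [hc, FormalMultilinearSeries.ofScalars, mul_comm] using h

lemma hasSum_negBinomialPMFReal {t θ : ℝ} (ht : 0 < t) (hθ : 0 < θ) :
    HasSum (negBinomialPMFReal t θ) 1 := by
  have ha : 0 < θ * t := mul_pos hθ ht
  have h1 : 0 < 1 + θ * t := by positivity
  have h := (hasSum_Gamma_div_mul_pow (r := 1 / t) (x := θ * t / (1 + θ * t)) (by positivity)
    (by positivity) (by rw [div_lt_one h1]; linarith)).mul_right (1 / (1 + θ * t) ^ (1 / t))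
  have hx : 1 - θ * t / (1 + θ * t) = (1 + θ * t)⁻¹ := by field_simp; ring
  convert! h using 1
  · ext k
    rw [negBinomialPMFReal, Real.rpow_add h1, Real.rpow_natCast, div_pow]
    have := Real.rpow_pos_of_pos h1 (1 / t)
    field_simp
  · rw [hx, Real.inv_rpow h1.le]
    have := Real.rpow_pos_of_pos h1 (1 / t)
    field_simp

lemma negBinomialPMFReal_nonneg {t θ : ℝ} (ht : 0 < t) (hθ : 0 < θ) (k : ℕ) :
    0 ≤ negBinomialPMFReal t θ k := by
  have h₁ : 0 < Real.Gamma (k + 1 / t) := Real.Gamma_pos_of_pos (by positivity)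
  have h₂ : 0 < Real.Gamma (1 / t) := Real.Gamma_pos_of_pos (by positivity)
  unfold negBinomialPMFReal
  positivity

lemma negBinomialPMFReal_succ {t θ : ℝ} (ht : 0 < t) (hθ : 0 < θ) (k : ℕ) :
    negBinomialPMFReal t θ (k + 1)
      = negBinomialPMFReal t θ k * ((k + 1 / t) * (θ * t / (1 + θ * t) / (k + 1))) := by
  have h1 : 0 < 1 + θ * t := by positivity
  have hG : 0 < Real.Gamma (1 / t) := Real.Gamma_pos_of_pos (by positivity)
  have hp := Real.rpow_pos_of_pos h1 ((k : ℝ) + 1 / t)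
  rw [negBinomialPMFReal, negBinomialPMFReal,
    show ((k + 1 : ℕ) : ℝ) + 1 / t = (k + 1 / t) + 1 by push_cast; ring,
    Real.Gamma_add_one (by positivity), Real.rpow_add_one h1.ne', Nat.factorial_succ, pow_succ]
  generalize (1 + θ * t) ^ ((k : ℝ) + 1 / t) = P at *
  generalize Real.Gamma (1 / t) = G at *
  generalize Real.Gamma (k + 1 / t) = H at *
  push_cast
  field_simp

/-- Size biasing a negative binomial distribution gives a shifted negative binomial
distribution. -/
lemma succ_mul_negBinomialPMFReal_succ {t θ : ℝ} (ht : 0 < t) (k : ℕ) :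
    ((k + 1 : ℕ) : ℝ) * negBinomialPMFReal t θ (k + 1)
      = θ * negBinomialPMFReal (t / (1 + t)) (θ * (1 + t)) k := by
  have hG : 0 < Real.Gamma (1 / t) := Real.Gamma_pos_of_pos (by positivity)
  have hinv : 1 / (t / (1 + t)) = 1 / t + 1 := by field_simp
  have ha : θ * (1 + t) * (t / (1 + t)) = θ * t := by field_simp
  rw [negBinomialPMFReal, negBinomialPMFReal, hinv, ha,
    show ((k + 1 : ℕ) : ℝ) + 1 / t = k + (1 / t + 1) by push_cast; ring,
    Real.Gamma_add_one (s := 1 / t) (by positivity), Nat.factorial_succ, pow_succ]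
  generalize (1 + θ * t) ^ ((k : ℝ) + (1 / t + 1)) = P
  generalize Real.Gamma (1 / t) = G at *
  generalize Real.Gamma (k + (1 / t + 1)) = H
  push_cast
  field_simp

lemma hasSum_mul_negBinomialPMFReal {t θ : ℝ} (ht : 0 < t) (hθ : 0 < θ) :
    HasSum (fun k : ℕ => (k : ℝ) * negBinomialPMFReal t θ k) θ := by
  rw [← hasSum_nat_add_iff' 1]
  simp only [succ_mul_negBinomialPMFReal_succ ht, Finset.sum_range_one, Nat.cast_zero, zero_mul,
    sub_zero]
  simpa using (hasSum_negBinomialPMFReal (t := t / (1 + t)) (θ := θ * (1 + t)) (by positivity)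
    (by positivity)).mul_left θ

lemma hasSum_integral_discreteMeasure {w : ℕ → ℝ} (hw : ∀ k, 0 ≤ w k) {φ : ℝ → ℝ}
    (hφ : Integrable φ (discreteMeasure w)) :
    HasSum (fun k : ℕ => w k * φ k) (∫ x, φ x ∂discreteMeasure w) := by
  simpa [integral_smul_measure, ENNReal.toReal_ofReal (hw _)] using! hasSum_integral_measure hφ

lemma hasSum_integral_ziMeasure {p : ℝ} (hp₀ : 0 ≤ p) (hp₁ : p < 1) {w : ℕ → ℝ}
    (hw : ∀ k, 0 ≤ w k) {φ : ℝ → ℝ} (hφ : Integrable φ (ziMeasure p (discreteMeasure w))) :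
    HasSum (fun k : ℕ => (1 - p) * w k * φ k)
      (∫ x, φ x ∂ziMeasure p (discreteMeasure w) - p * φ 0) := by
  have h1p : 0 < 1 - p := by linarith
  have hint : Integrable φ (discreteMeasure w) :=
    (integrable_smul_measure (by simpa using hp₁) ENNReal.ofReal_ne_top).1 hφ.right_of_add_measure
  have heq : ∫ x, φ x ∂ziMeasure p (discreteMeasure w)
      = p * φ 0 + (1 - p) * ∫ x, φ x ∂discreteMeasure w := by
    rw [ziMeasure, integral_add_measure hφ.left_of_add_measure hφ.right_of_add_measure,
      integral_smul_measure, integral_smul_measure, integral_dirac,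
      ENNReal.toReal_ofReal hp₀, ENNReal.toReal_ofReal h1p.le, smul_eq_mul, smul_eq_mul]
  rw [heq, add_sub_cancel_left]
  simpa only [mul_assoc] using (hasSum_integral_discreteMeasure hw hint).mul_left (1 - p)

/-- A Karlin–Novikov type criterion: if the weights `f` and `g` have the same first moment and
`g - f` changes sign at most once, from negative to nonnegative, on the positive integers,
then convex functions satisfy the comparison below. -/
lemma ConvexOn.hasSum_sub_ge_of_single_crossing {φ : ℝ → ℝ} (hφ : ConvexOn ℝ Set.univ φ)
    {f g : ℕ → ℝ} {A B M S T : ℝ} (hf : HasSum f A) (hg : HasSum g B)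
    (hfM : HasSum (fun k : ℕ => (k : ℝ) * f k) M) (hgM : HasSum (fun k : ℕ => (k : ℝ) * g k) M)
    (hfφ : HasSum (fun k : ℕ => f k * φ k) S) (hgφ : HasSum (fun k : ℕ => g k * φ k) T)
    (hcross : ∀ k, 1 ≤ k → f k ≤ g k → f (k + 1) ≤ g (k + 1)) :
    (B - A) * φ 0 ≤ T - S := by
  have hex : ∃ k, 1 ≤ k ∧ f k ≤ g k := by
    by_contra! h
    refine lt_irrefl M (hasSum_lt (i := 1) (fun k => ?_) ?_ hgM hfM)
    · rcases Nat.eq_zero_or_pos k with rfl | hk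
      · simp
      · exact mul_le_mul_of_nonneg_left (h k hk).le (Nat.cast_nonneg k)
    · simpa using h 1 le_rfl
  classical
  obtain ⟨hm1, hm⟩ := Nat.find_spec hex
  have hmin (k : ℕ) (hk : k < Nat.find hex) (hk1 : 1 ≤ k) : g k < f k := by
    simpa [hk1] using Nat.find_min hex hk
  generalize Nat.find hex = m at *
  have hup (k : ℕ) (hk : m ≤ k) : f k ≤ g k := by
    induction k, hk using Nat.le_induction with
    | base => exact hm
    | succ k hk ih => exact hcross k (hm1.trans hk) ih
  have hm0 : (0 : ℝ) < m := by exact_mod_cast hm1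
  set c := (φ m - φ 0) / m with hc
  have hsec {x y : ℝ} (hx : 0 < x) (hxy : x ≤ y) : (φ x - φ 0) / x ≤ (φ y - φ 0) / y := by
    simpa using hφ.secant_mono (Set.mem_univ 0) (Set.mem_univ x) (Set.mem_univ y) hx.ne'
      (hx.trans_le hxy).ne' hxy
  have hsum : HasSum (fun k : ℕ => (g k - f k) * (φ k - (φ 0 + c * k)))
      (T - S - (B - A) * φ 0) := by
    have h := (hgφ.sub hfφ).sub (((hg.sub hf).mul_right (φ 0)).add ((hgM.sub hfM).mul_right c))
    convert! h using 1
    · ext k; ring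
    · ring
  refine sub_nonneg.1 (hsum.nonneg fun k => ?_)
  rcases Nat.eq_zero_or_pos k with rfl | hk
  · simp
  have hk0 : (0 : ℝ) < k := by exact_mod_cast hk
  rcases lt_or_ge k m with hkm | hkm
  · have h := hsec hk0 (Nat.cast_le.2 hkm.le)
    rw [← hc, div_le_iff₀ hk0] at h
    exact mul_nonneg_of_nonpos_of_nonpos (by linarith [hmin k hkm hk]) (by linarith)
  · have h := hsec hm0 (Nat.cast_le.2 hkm)
    rw [← hc, le_div_iff₀ hk0] at h
    exact mul_nonneg (by linarith [hup k hkm]) (by linarith)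

/-- For every `t > 0`, `θ > 0` and `0 ≤ p₁ < p₂ < 1`, the zero-inflated
negative binomial distributions of the first kind satisfy `Z₁(t,θ,p₁) ≤cx Z₁(t,θ,p₂)`. -/
theorem zinb1_convexOrder (t θ p₁ p₂ : ℝ) (ht : 0 < t) (hθ : 0 < θ)
    (hp₁ : 0 ≤ p₁) (hp₁₂ : p₁ < p₂) (hp₂ : p₂ < 1) :
    ConvexOrder (ZINB₁ t θ p₁) (ZINB₁ t θ p₂) := by
  intro φ hφ hφ₁ hφ₂
  have h₁ : 0 < 1 - p₁ := by linarith
  have h₂ : 0 < 1 - p₂ := by linarith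
  have ht₁ : 0 < t * (1 - p₁) := mul_pos ht h₁
  have ht₂ : 0 < t * (1 - p₂) := mul_pos ht h₂
  have hθ₁ : 0 < θ / (1 - p₁) := div_pos hθ h₁
  have hθ₂ : 0 < θ / (1 - p₂) := div_pos hθ h₂
  have hmean {p : ℝ} (hp : 0 < 1 - p) : HasSum (fun k : ℕ => (k : ℝ) *
      ((1 - p) * negBinomialPMFReal (t * (1 - p)) (θ / (1 - p)) k)) θ := by
    have h := (hasSum_mul_negBinomialPMFReal (mul_pos ht hp) (div_pos hθ hp)).mul_left (1 - p)
    rw [mul_div_cancel₀ _ hp.ne'] at h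
    simpa only [mul_left_comm] using h
  have key := hφ.hasSum_sub_ge_of_single_crossing
    ((hasSum_negBinomialPMFReal ht₁ hθ₁).mul_left (1 - p₁))
    ((hasSum_negBinomialPMFReal ht₂ hθ₂).mul_left (1 - p₂)) (hmean h₁) (hmean h₂)
    (hasSum_integral_ziMeasure hp₁ (hp₁₂.trans hp₂) (negBinomialPMFReal_nonneg ht₁ hθ₁) hφ₁)
    (hasSum_integral_ziMeasure (hp₁.trans hp₁₂.le) hp₂ (negBinomialPMFReal_nonneg ht₂ hθ₂) hφ₂)
    (fun k _ hk => by
      have ha {p : ℝ} (hp : 0 < 1 - p) : θ / (1 - p) * (t * (1 - p)) = θ * t := by field_simp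
      rw [negBinomialPMFReal_succ ht₁ hθ₁, negBinomialPMFReal_succ ht₂ hθ₂, ha h₁, ha h₂]
      simp only [← mul_assoc]
      have hnn := mul_nonneg h₂.le (negBinomialPMFReal_nonneg ht₂ hθ₂ k)
      gcongr)
  change ∫ x, φ x ∂ziMeasure p₁ (discreteMeasure _) ≤ ∫ x, φ x ∂ziMeasure p₂ (discreteMeasure _)
  linarith

end
end

section
/- For every fixed 0 ≤ p < 1, every integer m ≥ 1 and every 0 < θ ≤ m(1-p), the zero-inflated binomial variables satisfy X(m,θ,p) ≤cx X(m+1,θ,p). -/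
open MeasureTheory Filter Topology ProbabilityTheory

noncomputable section

/-- The expectation of `f (k + B)` for `B` binomial with parameters `m` and `a`, defined by
conditioning on one trial at a time. -/
def binomialExpect (f : ℕ → ℝ) (a : ℝ) : ℕ → ℕ → ℝ
  | 0, k => f k
  | m + 1, k => (1 - a) * binomialExpect f a m k + a * binomialExpect f a m (k + 1)

lemma binomialExpect_fwdDiff (f : ℕ → ℝ) (a : ℝ) (m k : ℕ) :
    binomialExpect (fun j => f (j + 1) - f j) a m k =
      binomialExpect f a m (k + 1) - binomialExpect f a m k := by
  induction m generalizing k with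
  | zero => rfl
  | succ m ih => simp only [binomialExpect, ih]; ring

lemma hasDerivAt_binomialExpect (f : ℕ → ℝ) (a : ℝ) (m k : ℕ) :
    HasDerivAt (fun x => binomialExpect f x (m + 1) k)
      ((m + 1) * binomialExpect (fun j => f (j + 1) - f j) a m k) a := by
  induction m generalizing k with
  | zero =>
    have h := (((hasDerivAt_id a).const_sub 1).mul_const (f k)).add
      ((hasDerivAt_id a).mul_const (f (k + 1)))
    refine h.congr_deriv ?_
    simp only [binomialExpect]
    push_cast
    ring
  | succ m ih =>
    have h := (((hasDerivAt_id a).const_sub 1).mul (ih k)).add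
      ((hasDerivAt_id a).mul (ih (k + 1)))
    refine h.congr_deriv ?_
    have hd := binomialExpect_fwdDiff f a (m + 1) k
    simp only [binomialExpect, id] at hd ⊢
    push_cast
    linear_combination -hd

lemma monotone_binomialExpect {f : ℕ → ℝ} (hf : Monotone f) {a : ℝ} (ha₀ : 0 ≤ a) (ha₁ : a ≤ 1)
    (m : ℕ) : Monotone (binomialExpect f a m) := by
  induction m with
  | zero => exact hf
  | succ m ih =>
    intro i j hij
    exact add_le_add (mul_le_mul_of_nonneg_left (ih hij) (by linarith))
      (mul_le_mul_of_nonneg_left (ih (by omega)) ha₀)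

lemma binomialExpect_eq_sum (f : ℕ → ℝ) (a : ℝ) (m k : ℕ) :
    binomialExpect f a m k =
      ∑ j ∈ Finset.range (m + 1), binomialPMFReal m a j * f (k + j) := by
  suffices h : binomialExpect f a m k = ∑ ij ∈ Finset.HasAntidiagonal.antidiagonal m,
      (m.choose ij.1 : ℝ) * (a ^ ij.1 * (1 - a) ^ ij.2 * f (k + ij.1)) by
    rw [h, Finset.Nat.sum_antidiagonal_eq_sum_range_succ
      (fun i j => (m.choose i : ℝ) * (a ^ i * (1 - a) ^ j * f (k + i)))]
    exact Finset.sum_congr rfl fun j _ => by simp only [binomialPMFReal]; ring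
  induction m generalizing k with
  | zero => simp [binomialExpect]
  | succ m ih =>
    rw [Finset.sum_antidiagonal_choose_succ_mul
      (fun i j => a ^ i * (1 - a) ^ j * f (k + i)), binomialExpect, ih, ih,
      Finset.mul_sum, Finset.mul_sum]
    congr 1
    · exact Finset.sum_congr rfl fun ij _ => by ring
    · refine Finset.sum_congr rfl fun ij hij => ?_
      rw [← Finset.HasAntidiagonal.mem_antidiagonal.mp hij, Nat.choose_symm_add,
        show k + 1 + ij.1 = k + (ij.1 + 1) by ring]
      ring

/-- A binomial expectation of a convex sequence increases when one trial is added and the mean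
is kept fixed. -/
lemma binomialExpect_le_succ {f : ℕ → ℝ} (hf : Monotone fun j => f (j + 1) - f j) (m k : ℕ)
    {a b : ℝ} (ha₀ : 0 ≤ a) (ha₁ : a ≤ 1) (hab : (m + 1) * a = (m + 2) * b) :
    binomialExpect f a (m + 1) k ≤ binomialExpect f b (m + 2) k := by
  have hm : (0 : ℝ) ≤ m := m.cast_nonneg
  have hb₀ : 0 ≤ b := by
    by_contra! h
    nlinarith [mul_nonneg hm ha₀]
  have hba : b ≤ a := by
    by_contra! h
    nlinarith
  have hderiv (x : ℝ) : HasDerivAt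
      (fun x => (1 - (m + 1) * (a - x)) * binomialExpect f x (m + 1) k +
        (m + 1) * (a - x) * binomialExpect f x (m + 1) (k + 1))
      ((m + 1) * ((m + 1) * (a - x) - x) *
        (binomialExpect (fun j => f (j + 1) - f j) x m (k + 1) -
          binomialExpect (fun j => f (j + 1) - f j) x m k)) x := by
    have hc : HasDerivAt (fun x => ((m : ℝ) + 1) * (a - x)) (((m : ℝ) + 1) * -1) x :=
      ((hasDerivAt_id x).const_sub a).const_mul _
    refine (((hc.const_sub 1).mul (hasDerivAt_binomialExpect f x m k)).add
      (hc.mul (hasDerivAt_binomialExpect f x m (k + 1)))).congr_deriv ?_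
    have hd := binomialExpect_fwdDiff f x (m + 1) k
    simp only [binomialExpect] at hd ⊢
    linear_combination ((m : ℝ) + 1) * hd
  have hanti := antitoneOn_of_deriv_nonpos (convex_Icc b a)
    (fun x _ => (hderiv x).continuousAt.continuousWithinAt)
    (fun x _ => (hderiv x).differentiableAt.differentiableWithinAt) (fun x hx => by
      rw [interior_Icc] at hx
      rw [(hderiv x).deriv]
      have hmono := monotone_binomialExpect hf (hb₀.trans hx.1.le) (hx.2.le.trans ha₁) m
        k.le_succ
      refine mul_nonpos_of_nonpos_of_nonneg ?_ (sub_nonneg.mpr hmono)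
      refine mul_nonpos_of_nonneg_of_nonpos (by positivity) ?_
      nlinarith [hx.1])
  have h := hanti (Set.left_mem_Icc.mpr hba) (Set.right_mem_Icc.mpr hba) hba
  have hb : ((m : ℝ) + 1) * (a - b) = b := by linear_combination hab
  simpa [hb, binomialExpect] using h

lemma ConvexOn.monotone_fwdDiff_natCast {φ : ℝ → ℝ} (hφ : ConvexOn ℝ Set.univ φ) :
    Monotone fun j : ℕ => φ ((j + 1 : ℕ) : ℝ) - φ j := by
  refine monotone_nat_of_le_succ fun j => ?_
  have h := hφ.2 (Set.mem_univ (j : ℝ)) (Set.mem_univ ((j + 1 + 1 : ℕ) : ℝ))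
    (by norm_num : (0 : ℝ) ≤ 1 / 2) (by norm_num : (0 : ℝ) ≤ 1 / 2) (by norm_num)
  have hmid : (1 / 2 : ℝ) • (j : ℝ) + (1 / 2 : ℝ) • ((j + 1 + 1 : ℕ) : ℝ) = ((j + 1 : ℕ) : ℝ) := by
    simp only [smul_eq_mul]
    push_cast
    ring
  rw [hmid] at h
  simp only [smul_eq_mul] at h
  linarith

lemma integral_binomialMeasure {φ : ℝ → ℝ} {m : ℕ} {q : ℝ} (hq₀ : 0 ≤ q) (hq₁ : q ≤ 1)
    (hφ : Integrable φ (binomialMeasure m q)) :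
    ∫ x, φ x ∂binomialMeasure m q = binomialExpect (fun k => φ k) q m 0 := by
  rw [binomialMeasure, discreteMeasure] at hφ ⊢
  rw [integral_sum_measure hφ, binomialExpect_eq_sum, tsum_eq_sum (s := Finset.range (m + 1))]
  · refine Finset.sum_congr rfl fun k _ => ?_
    have hw : 0 ≤ binomialPMFReal m q k :=
      mul_nonneg (by positivity) (pow_nonneg (sub_nonneg.mpr hq₁) _)
    simp [ENNReal.toReal_ofReal hw]
  · intro k hk
    have hmk : m < k := by simpa using hk
    simp [binomialPMFReal, Nat.choose_eq_zero_of_lt hmk]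

lemma integral_ziMeasure {φ : ℝ → ℝ} {p : ℝ} (hp₀ : 0 ≤ p) (hp₁ : p < 1) {μ : Measure ℝ}
    (hφ : Integrable φ (ziMeasure p μ)) :
    Integrable φ μ ∧ ∫ x, φ x ∂ziMeasure p μ = p * φ 0 + (1 - p) * ∫ x, φ x ∂μ := by
  rw [ziMeasure] at hφ ⊢
  obtain ⟨h₀, h₁⟩ := integrable_add_measure.mp hφ
  refine ⟨(integrable_smul_measure (by simpa using hp₁) ENNReal.ofReal_ne_top).mp h₁, ?_⟩
  rw [integral_add_measure h₀ h₁, integral_smul_measure, integral_smul_measure, integral_dirac,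
    ENNReal.toReal_ofReal hp₀, ENNReal.toReal_ofReal (sub_nonneg.mpr hp₁.le)]
  simp only [smul_eq_mul]

/-- For every fixed `0 ≤ p < 1`, every integer `m ≥ 1` and every
`0 < θ ≤ m(1-p)`, the zero-inflated binomial distributions satisfy
`X(m,θ,p) ≤cx X(m+1,θ,p)`. -/
theorem zib_convexOrder_succ (p : ℝ) (hp₀ : 0 ≤ p) (hp₁ : p < 1)
    (m : ℕ) (hm : 1 ≤ m) (θ : ℝ) (hθ : 0 < θ) (hθm : θ ≤ m * (1 - p)) :
    ConvexOrder (ZIB m θ p) (ZIB (m + 1) θ p) := by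
  intro φ hφ hX hY
  obtain ⟨m, rfl⟩ := Nat.exists_eq_add_of_le' hm
  have hp : 0 < 1 - p := sub_pos.mpr hp₁
  have ha₁ : θ / ((m + 1 : ℕ) * (1 - p)) ≤ 1 := (div_le_one (by positivity)).mpr hθm
  have hb₁ : θ / ((m + 1 + 1 : ℕ) * (1 - p)) ≤ 1 := by
    refine (div_le_one (by positivity)).mpr (hθm.trans ?_)
    gcongr
    omega
  obtain ⟨hX', hXeq⟩ := integral_ziMeasure hp₀ hp₁ hX
  obtain ⟨hY', hYeq⟩ := integral_ziMeasure hp₀ hp₁ hY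
  rw [ZIB, ZIB, hXeq, hYeq, integral_binomialMeasure (by positivity) ha₁ hX',
    integral_binomialMeasure (by positivity) hb₁ hY']
  gcongr
  refine binomialExpect_le_succ hφ.monotone_fwdDiff_natCast m 0 (by positivity) ha₁ ?_
  push_cast
  field_simp
  ring

end
end
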